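/- Quadrilinear L¹ estimate in ℝ^{3+1}. Let s ∈ (5/6, 1) and let ε > 0 be sufficiently small. There is a constant C = C(s, ε, m₁) such that for every N ≥ 1 and all Schwartz functions φ₁, φ₂, φ₃, ψ on ℝ³ × ℝ, ‖(∇ I_N φ₁) · conj(φ₂) · φ₃ · ψ‖_{L¹(ℝ³ × ℝ)} ≤ C ‖ψ‖_{X_{0, 1/2−2ε}} ‖∇ I_N φ₁‖_{X_{0, 1/2+ε}} ‖∇ I_N φ₂‖_{X_{0, 1/2+ε}} ‖∇ I_N φ₃‖_{X_{0, 1/2+ε}}. -/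

import Mathlib

open MeasureTheory Complex Set
open scoped FourierTransform BigOperators RealInnerProductSpace

noncomputable section

abbrev Rn (n : ℕ) := EuclideanSpace ℝ (Fin n)

/-- Japanese bracket of a vector. -/
def jap {n : ℕ} (ξ : Rn n) : ℝ := Real.sqrt (1 + ‖ξ‖ ^ 2)

/-- Japanese bracket of a real number. -/
def japR (x : ℝ) : ℝ := Real.sqrt (1 + x ^ 2)

/-- Inhomogeneous Sobolev norm ‖⟨ξ⟩^s f̂‖_{L²}. -/
def sobNorm (n : ℕ) (s : ℝ) (f : Rn n → ℂ) : ℝ :=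
  (∫ ξ : Rn n, jap ξ ^ (2 * s) * ‖𝓕 f ξ‖ ^ 2) ^ (1/2 : ℝ)

/-- Homogeneous Sobolev norm ‖|ξ|^s f̂‖_{L²}. -/
def sobNormHom (n : ℕ) (s : ℝ) (f : Rn n → ℂ) : ℝ :=
  (∫ ξ : Rn n, ‖ξ‖ ^ (2 * s) * ‖𝓕 f ξ‖ ^ 2) ^ (1/2 : ℝ)

/-- L^p norm on ℝⁿ. -/
def lpNorm (n : ℕ) (p : ℝ) (f : Rn n → ℂ) : ℝ :=
  (∫ x : Rn n, ‖f x‖ ^ p) ^ (1/p)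

/-- Laplacian: sum of second partial derivatives. -/
def laplacian {n : ℕ} (f : Rn n → ℂ) (x : Rn n) : ℂ :=
  ∑ i : Fin n, fderiv ℝ (fun y => fderiv ℝ f y (EuclideanSpace.single i 1)) x
    (EuclideanSpace.single i 1)

/-- Complex gradient as a vector in Euclidean space. -/
def gradC {n : ℕ} (f : Rn n → ℂ) (x : Rn n) : EuclideanSpace ℂ (Fin n) :=
  (WithLp.equiv 2 (Fin n → ℂ)).symm fun i => fderiv ℝ f x (EuclideanSpace.single i 1)

/-- φ is a solution of the cubic defocussing NLS on ℝⁿ × [0,T] with data φ₀: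
smooth, Schwartz in x uniformly for t ∈ [0,T] (with all derivatives),
satisfying i∂ₜφ + Δφ = |φ|²φ and φ(·,0) = φ₀. -/
def IsNLSSolution (n : ℕ) (T : ℝ) (φ : Rn n → ℝ → ℂ) (φ₀ : Rn n → ℂ) : Prop :=
  ContDiff ℝ (⊤ : ℕ∞) (fun p : Rn n × ℝ => φ p.1 p.2) ∧
  (∀ k l : ℕ, ∃ C : ℝ, ∀ t ∈ Icc (0:ℝ) T, ∀ x : Rn n,
      ‖x‖ ^ k * ‖iteratedFDeriv ℝ l (fun y => φ y t) x‖ ≤ C) ∧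
  (∀ x : Rn n, ∀ t ∈ Icc (0:ℝ) T,
      Complex.I * deriv (fun t' => φ x t') t + laplacian (fun y => φ y t) x
        = (‖φ x t‖ : ℂ) ^ 2 * φ x t) ∧
  (∀ x : Rn n, φ x 0 = φ₀ x)

/-- The energy E(f) = ∫ (1/2)|∇f|² + (1/4)|f|⁴. -/
def energy {n : ℕ} (f : Rn n → ℂ) : ℝ :=
  ∫ x : Rn n, ((1/2 : ℝ) * ∑ i : Fin n, ‖fderiv ℝ f x (EuclideanSpace.single i 1)‖ ^ 2
    + (1/4 : ℝ) * ‖f x‖ ^ 4)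

/-- m₁ is a smooth, radially symmetric, nonincreasing multiplier with
m₁ = 1 on the unit ball, m₁(ξ) = |ξ|^{-(1-s)} for |ξ| ≥ 2, 0 < m₁ ≤ 1. -/
def IsAdmissibleMultiplier (n : ℕ) (s : ℝ) (m₁ : Rn n → ℝ) : Prop :=
  ContDiff ℝ (⊤ : ℕ∞) m₁ ∧
  (∀ ξ : Rn n, 0 < m₁ ξ ∧ m₁ ξ ≤ 1) ∧
  (∀ ξ η : Rn n, ‖ξ‖ = ‖η‖ → m₁ ξ = m₁ η) ∧
  (∀ ξ η : Rn n, ‖ξ‖ ≤ ‖η‖ → m₁ η ≤ m₁ ξ) ∧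
  (∀ ξ : Rn n, ‖ξ‖ ≤ 1 → m₁ ξ = 1) ∧
  (∀ ξ : Rn n, 2 ≤ ‖ξ‖ → m₁ ξ = ‖ξ‖ ^ (-(1 - s)))

/-- The rescaled multiplier m_N(ξ) = m₁(ξ/N). -/
def mN {n : ℕ} (m₁ : Rn n → ℝ) (N : ℝ) (ξ : Rn n) : ℝ := m₁ (N⁻¹ • ξ)

/-- The smoothing operator I_N with Fourier multiplier m_N. -/
def Iop {n : ℕ} (m₁ : Rn n → ℝ) (N : ℝ) (f : Rn n → ℂ) : Rn n → ℂ :=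
  fun x => 𝓕⁻ (fun ξ => (mN m₁ N ξ : ℂ) * 𝓕 f ξ) x

/-- The spatial multiplier ⟨∇⟩^s. -/
def japMul (n : ℕ) (s : ℝ) (f : Rn n → ℂ) : Rn n → ℂ :=
  fun x => 𝓕⁻ (fun ξ => ((jap ξ ^ s : ℝ) : ℂ) * 𝓕 f ξ) x

/-- Sharp Littlewood–Paley projection onto {M ≤ ⟨ξ⟩ ≤ 2M}. -/
def LP (n : ℕ) (M : ℝ) (f : Rn n → ℂ) : Rn n → ℂ :=
  fun x => 𝓕⁻ (fun ξ => if M ≤ jap ξ ∧ jap ξ ≤ 2 * M then 𝓕 f ξ else 0) x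

/-- Space-time Fourier transform ψ̃(ξ,τ). -/
def stFourier (n : ℕ) {E : Type*} [NormedAddCommGroup E] [NormedSpace ℂ E]
    (ψ : Rn n → ℝ → E) (ξ : Rn n) (τ : ℝ) : E :=
  ∫ x : Rn n, ∫ t : ℝ,
    Complex.exp (Complex.I * ((-2 * Real.pi * (⟪x, ξ⟫ + t * τ) : ℝ) : ℂ)) • ψ x t

/-- The X_{s,b} norm ‖⟨ξ⟩^s ⟨τ-|ξ|²⟩^b ψ̃‖_{L²}. -/
def XNorm (n : ℕ) {E : Type*} [NormedAddCommGroup E] [NormedSpace ℂ E]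
    (s b : ℝ) (ψ : Rn n → ℝ → E) : ℝ :=
  (∫ ξ : Rn n, ∫ τ : ℝ,
    jap ξ ^ (2 * s) * japR (τ - ‖ξ‖ ^ 2) ^ (2 * b) * ‖stFourier n ψ ξ τ‖ ^ 2) ^ (1/2 : ℝ)

/-- The restricted norm X^δ_{s,b}: infimum over Schwartz extensions off ℝⁿ × [0,δ]. -/
def XRNorm (n : ℕ) {E : Type*} [NormedAddCommGroup E] [NormedSpace ℂ E]
    (s b δ : ℝ) (f : Rn n → ℝ → E) : ℝ :=
  sInf { r : ℝ | ∃ ψ : SchwartzMap (Rn n × ℝ) E,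
    (∀ x : Rn n, ∀ t ∈ Icc (0:ℝ) δ, ψ (x, t) = f x t) ∧
    r = XNorm n s b (fun x t => ψ (x, t)) }

/-- Space-time L^p norm on ℝⁿ × ℝ. -/
def lpNormST (n : ℕ) {E : Type*} [NormedAddCommGroup E] (p : ℝ) (F : Rn n → ℝ → E) : ℝ :=
  (∫ t : ℝ, ∫ x : Rn n, ‖F x t‖ ^ p) ^ (1/p)

/-- Space-time L^p norm on ℝⁿ × [0,δ]. -/
def lpNormSTt (n : ℕ) {E : Type*} [NormedAddCommGroup E] (p δ : ℝ) (F : Rn n → ℝ → E) : ℝ :=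
  (∫ t in Icc (0:ℝ) δ, ∫ x : Rn n, ‖F x t‖ ^ p) ^ (1/p)

/-- The decaying weight `(1 + |x|)^(-r)` on the line, valued in `[0, ∞]`. -/
def decay (r x : ℝ) : ENNReal := ENNReal.ofReal ((1 + |x|) ^ (-r))

@[fun_prop]
lemma measurable_decay (r : ℝ) : Measurable (decay r) := by
  unfold decay; fun_prop

lemma decay_anti_abs {r x y : ℝ} (hr : 0 ≤ r) (h : |x| ≤ |y|) : decay r y ≤ decay r x := by
  apply ENNReal.ofReal_le_ofReal
  exact Real.rpow_le_rpow_of_nonpos (by positivity) (by linarith) (by linarith)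

lemma decay_le_one {r x : ℝ} (hr : 0 ≤ r) : decay r x ≤ 1 := by
  rw [decay, ← ENNReal.ofReal_one]
  apply ENNReal.ofReal_le_ofReal
  exact Real.rpow_le_one_of_one_le_of_nonpos (by linarith [abs_nonneg x]) (by linarith)

lemma decay_mul_decay (p q x : ℝ) : decay p x * decay q x = decay (p + q) x := by
  rw [decay, decay, decay, ← ENNReal.ofReal_mul (by positivity),
    ← Real.rpow_add (by positivity)]
  ring_nf

/-- Young-type splitting of a product of two decaying weights. -/
lemma decay_mul_decay_le {p q : ℝ} (hp : 0 ≤ p) (hq : 0 ≤ q) (x y : ℝ) :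
    decay p x * decay q y ≤ decay (p + q) x + decay (p + q) y := by
  rcases le_total |x| |y| with h | h
  · calc decay p x * decay q y ≤ decay p x * decay q x := by
          gcongr; exact decay_anti_abs hq h
      _ = decay (p + q) x := decay_mul_decay _ _ _
      _ ≤ _ := le_self_add
  · calc decay p x * decay q y ≤ decay p y * decay q y := by
          gcongr; exact decay_anti_abs hp h
      _ = decay (p + q) y := decay_mul_decay _ _ _
      _ ≤ _ := le_add_self

lemma lintegral_decay_lt_top {r : ℝ} (hr : 1 < r) : ∫⁻ x, decay r x < ⊤ := by
  have h : Integrable (fun x : ℝ ↦ (1 + ‖x‖) ^ (-r)) volume :=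
    integrable_one_add_norm (by simpa using hr)
  have := h.lintegral_lt_top
  simpa [decay, Real.norm_eq_abs] using this

lemma lintegral_decay_add (r a : ℝ) : ∫⁻ x, decay r (x + a) = ∫⁻ x, decay r x :=
  lintegral_add_right_eq_self (decay r) a

lemma lintegral_decay_sub_left (r a : ℝ) : ∫⁻ x, decay r (a - x) = ∫⁻ x, decay r x :=
  lintegral_sub_left_eq_self (decay r) a

lemma decay_half_le {r : ℝ} (hr : 0 ≤ r) {x y : ℝ} (h : |y| ≤ 2 * |x|) :
    decay r x ≤ ENNReal.ofReal (2 ^ r) * decay r y := by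
  rw [decay, decay, ← ENNReal.ofReal_mul (by positivity)]
  apply ENNReal.ofReal_le_ofReal
  calc (1 + |x|) ^ (-r) ≤ ((1 + |y|) / 2) ^ (-r) :=
        Real.rpow_le_rpow_of_nonpos (by positivity) (by linarith) (by linarith)
    _ = 2 ^ r * (1 + |y|) ^ (-r) := by
        rw [Real.div_rpow (by positivity) (by norm_num), Real.rpow_neg (by norm_num : (0:ℝ) ≤ 2)]
        field_simp

/-- Convolution of two decaying weights, the first of them integrable. -/
lemma lintegral_decay_conv_le {p r : ℝ} (hr : 0 ≤ r) (hrp : r ≤ p) (A B : ℝ) :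
    ∫⁻ t, decay p (t - A) * decay r (B - t) ≤
      ENNReal.ofReal (2 ^ r) * (2 * ∫⁻ x, decay p x) * decay r (B - A) := by
  have key : ∀ t, decay p (t - A) * decay r (B - t) ≤
      ENNReal.ofReal (2 ^ r) * decay r (B - A) * (decay p (t - A) + decay p (B - t)) := by
    intro t
    have tri : |B - A| ≤ |t - A| + |B - t| := by
      have := abs_add_le (t - A) (B - t); simpa using this
    rcases le_total |t - A| |B - t| with h | h
    · have := decay_half_le hr (x := B - t) (y := B - A) (by linarith)
      calc _ ≤ decay p (t - A) * (ENNReal.ofReal (2 ^ r) * decay r (B - A)) := by gcongr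
        _ = ENNReal.ofReal (2 ^ r) * decay r (B - A) * decay p (t - A) := by ring
        _ ≤ _ := by gcongr; exact le_self_add
    · have := decay_half_le hr (x := t - A) (y := B - A) (by linarith)
      calc _ = decay r (t - A) * (decay (p - r) (t - A) * decay r (B - t)) := by
            rw [← mul_assoc, decay_mul_decay]; ring_nf
        _ ≤ (ENNReal.ofReal (2 ^ r) * decay r (B - A)) *
              (decay (p - r + r) (t - A) + decay (p - r + r) (B - t)) := by
            gcongr; exact decay_mul_decay_le (by linarith) hr _ _
        _ = _ := by ring_nf
  calc _ ≤ ∫⁻ t, ENNReal.ofReal (2 ^ r) * decay r (B - A) *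
        (decay p (t - A) + decay p (B - t)) := lintegral_mono key
    _ = _ := by
      rw [lintegral_const_mul _ (by fun_prop), lintegral_add_left (by fun_prop),
        lintegral_decay_sub_left]
      simp_rw [sub_eq_add_neg _ A]
      rw [lintegral_decay_add]; ring

lemma lintegral_quadratic_decay_le_of_injOn (b : ℝ) {s : Set ℝ} (hs : MeasurableSet s)
    (hinj : InjOn (fun x : ℝ ↦ x ^ 2) s) (h1 : ∀ x ∈ s, 1 ≤ |x|) :
    ∫⁻ x in s, decay (-(2 / 3)) x * decay (9 / 10) (b - 2 * x ^ 2) ≤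
      2 * (2 * ∫⁻ x, decay (16 / 15) x) := by
  have key : ∀ x ∈ s, decay (-(2 / 3)) x * decay (9 / 10) (b - 2 * x ^ 2) ≤
      ENNReal.ofReal |2 * x| *
        (2 * (decay (16 / 15) (x ^ 2) + decay (16 / 15) (b / 2 - x ^ 2))) := by
    intro x hx
    have hx1 := h1 x hx
    have e1 : decay (-(2 / 3)) x ≤ ENNReal.ofReal |2 * x| * (2 * decay (1 / 6) (x ^ 2)) := by
      rw [decay, decay, ← ENNReal.ofReal_ofNat 2, ← ENNReal.ofReal_mul (by positivity),
        ← ENNReal.ofReal_mul (by positivity)]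
      apply ENNReal.ofReal_le_ofReal
      rw [abs_mul, abs_two, abs_of_nonneg (sq_nonneg x), ← sq_abs x]
      set y := |x|
      have hy : 0 < y := by linarith
      calc (1 + y) ^ (-(-(2 / 3)) : ℝ) ≤ (2 * y) ^ (-(-(2 / 3)) : ℝ) :=
            Real.rpow_le_rpow (by positivity) (by linarith) (by norm_num)
        _ = (2 * y) * (2 * y) ^ (-(1 / 3) : ℝ) := by
            rw [← Real.rpow_one_add' (by positivity) (by norm_num)]; norm_num
        _ = (2 * y) * ((2 * y) ^ 2) ^ (-(1 / 6) : ℝ) := by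
            rw [← Real.rpow_natCast, ← Real.rpow_mul (by positivity)]; norm_num
        _ ≤ (2 * y) * (1 + y ^ 2) ^ (-(1 / 6) : ℝ) := by
            gcongr ?_ * ?_
            exact Real.rpow_le_rpow_of_nonpos (by positivity) (by nlinarith) (by norm_num)
        _ ≤ _ := by
            gcongr ?_ * ?_
            have : 0 ≤ (1 + y ^ 2) ^ (-(1 / 6) : ℝ) := by positivity
            linarith
    have e2 : decay (9 / 10) (b - 2 * x ^ 2) ≤ decay (9 / 10) (b / 2 - x ^ 2) := by
      apply decay_anti_abs (by norm_num)
      have : b - 2 * x ^ 2 = 2 * (b / 2 - x ^ 2) := by ring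
      rw [this, abs_mul, abs_two]
      linarith [abs_nonneg (b / 2 - x ^ 2)]
    calc _ ≤ ENNReal.ofReal |2 * x| * (2 * decay (1 / 6) (x ^ 2)) *
          decay (9 / 10) (b / 2 - x ^ 2) := by gcongr
      _ = ENNReal.ofReal |2 * x| *
          (2 * (decay (1 / 6) (x ^ 2) * decay (9 / 10) (b / 2 - x ^ 2))) := by ring
      _ ≤ ENNReal.ofReal |2 * x| * (2 * (decay (1 / 6 + 9 / 10) (x ^ 2) +
            decay (1 / 6 + 9 / 10) (b / 2 - x ^ 2))) := by
          gcongr; exact decay_mul_decay_le (by norm_num) (by norm_num) _ _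
      _ = _ := by norm_num
  calc _ ≤ ∫⁻ x in s, ENNReal.ofReal |2 * x| *
        (2 * (decay (16 / 15) (x ^ 2) + decay (16 / 15) (b / 2 - x ^ 2))) :=
        setLIntegral_mono' hs key
    _ = ∫⁻ y in (fun x : ℝ ↦ x ^ 2) '' s,
          2 * (decay (16 / 15) y + decay (16 / 15) (b / 2 - y)) := by
        rw [lintegral_image_eq_lintegral_abs_deriv_mul hs (f' := fun x ↦ 2 * x) _ hinj]
        intro x _
        simpa using (hasDerivAt_pow 2 x).hasDerivWithinAt
    _ ≤ ∫⁻ y, 2 * (decay (16 / 15) y + decay (16 / 15) (b / 2 - y)) := setLIntegral_le_lintegral _ _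
    _ = _ := by
        rw [lintegral_const_mul _ (by fun_prop), lintegral_add_left (by fun_prop),
          lintegral_decay_sub_left]
        ring

lemma exists_lintegral_quadratic_decay_le : ∃ C : ENNReal, C ≠ ⊤ ∧ ∀ b : ℝ,
    ∫⁻ x, decay (-(2 / 3)) x * decay (9 / 10) (b - 2 * x ^ 2) ≤ C := by
  have hI := (lintegral_decay_lt_top (r := 16 / 15) (by norm_num)).ne
  refine ⟨ENNReal.ofReal (2 ^ (2 / 3 : ℝ)) * 2 + 2 * (2 * ∫⁻ x, decay (16 / 15) x) +
    2 * (2 * ∫⁻ x, decay (16 / 15) x), by finiteness, fun b ↦ ?_⟩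
  have hcov : (univ : Set ℝ) ⊆ (Icc (-1) 1 ∪ Ici 1) ∪ Iic (-1) := by
    intro x _
    simp only [mem_union, mem_Icc, mem_Ici, mem_Iic]
    by_cases h : x ≤ -1
    · right; exact h
    · left
      by_cases h' : 1 ≤ x
      · right; exact h'
      · left; constructor <;> linarith
  rw [← setLIntegral_univ]
  refine (lintegral_mono_set hcov).trans ((lintegral_union_le _ _ _).trans ?_)
  gcongr
  · refine (lintegral_union_le _ _ _).trans ?_
    gcongr
    · calc _ ≤ ∫⁻ x in Icc (-1 : ℝ) 1, ENNReal.ofReal (2 ^ (2 / 3 : ℝ)) := by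
            refine setLIntegral_mono' measurableSet_Icc fun x hx ↦ ?_
            rw [← mul_one (ENNReal.ofReal _)]
            gcongr
            · apply ENNReal.ofReal_le_ofReal
              rw [neg_neg]
              have : |x| ≤ 1 := abs_le.2 hx
              exact Real.rpow_le_rpow (by positivity) (by linarith) (by norm_num)
            · exact decay_le_one (by norm_num)
        _ = _ := by rw [setLIntegral_const, Real.volume_Icc]; norm_num
    · refine lintegral_quadratic_decay_le_of_injOn b measurableSet_Ici ?_ ?_
      · intro x hx y hy h
        simp only [mem_Ici] at hx hy
        exact (pow_left_inj₀ (by linarith) (by linarith) two_ne_zero).1 h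
      · intro x hx
        exact le_trans hx (le_abs_self x)
  · refine lintegral_quadratic_decay_le_of_injOn b measurableSet_Iic ?_ ?_
    · intro x hx y hy h
      simp only [mem_Iic] at hx hy
      have h' : (-x) ^ 2 = (-y) ^ 2 := by simpa using h
      linarith [(pow_left_inj₀ (by linarith) (by linarith) two_ne_zero).1 h']
    · intro x hx
      simp only [mem_Iic] at hx
      exact le_trans (by linarith) (neg_le_abs x)

/-- The weight `|ξ|⁻²` restricted to the unit ball of `ℝ³`. -/
def lowWeight (ξ : Rn 3) : ENNReal :=
  (Metric.ball (0 : Rn 3) 1).indicator (fun ξ ↦ ENNReal.ofReal ((‖ξ‖ ^ 2)⁻¹)) ξ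

@[fun_prop]
lemma measurable_lowWeight : Measurable lowWeight := by
  unfold lowWeight
  exact Measurable.indicator (by fun_prop) measurableSet_ball

lemma lintegral_lowWeight_lt_top : ∫⁻ ξ, lowWeight ξ < ⊤ := by
  have h : IntegrableOn (fun ξ : Rn 3 ↦ (‖ξ‖ ^ 2)⁻¹) (Metric.ball 0 1) volume := by
    rw [integrableOn_fun_norm_addHaar volume (f := fun y ↦ (y ^ 2)⁻¹)]
    refine (integrableOn_const (C := (1 : ℝ)) (s := Ioo 0 1) (by simp)).congr_fun ?_
      measurableSet_Ioo
    intro y hy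
    have : y ≠ 0 := hy.1.ne'
    simp [this]
  unfold lowWeight
  rw [lintegral_indicator measurableSet_ball]
  exact h.lintegral_lt_top

lemma lintegral_eq_lintegral_insertNth {n : ℕ} (i : Fin (n + 1)) {f : Rn (n + 1) → ENNReal}
    (hf : Measurable f) :
    ∫⁻ ξ, f ξ = ∫⁻ y : Fin n → ℝ, ∫⁻ x : ℝ, f (WithLp.toLp 2 (i.insertNth x y)) := by
  rw [← (PiLp.volume_preserving_toLp (Fin (n + 1))).lintegral_comp hf,
    ← (volume_preserving_piFinSuccAbove (fun _ : Fin (n + 1) ↦ ℝ) i).symm.lintegral_comp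
      (by fun_prop)]
  rw [Measure.volume_eq_prod, lintegral_prod_symm]
  · rfl
  · apply Measurable.aemeasurable
    exact hf.comp ((WithLp.measurable_toLp 2 _).comp (MeasurableEquiv.measurable _))

lemma lintegral_fin_two_prod {g : Fin 2 → ℝ → ENNReal} (hg : ∀ j, Measurable (g j)) :
    ∫⁻ y : Fin 2 → ℝ, ∏ j, g j (y j) = ∏ j, ∫⁻ t, g j t := by
  have hm : Measurable fun z : ℝ × ℝ ↦ g 0 z.1 * g 1 z.2 :=
    ((hg 0).comp measurable_fst).mul ((hg 1).comp measurable_snd)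
  simp only [Fin.prod_univ_two]
  rw [← lintegral_prod_mul (hg 0).aemeasurable (hg 1).aemeasurable, ← Measure.volume_eq_prod,
    ← (volume_preserving_piFinTwo (fun _ ↦ ℝ)).lintegral_comp hm]
  rfl

/-- A weight on `ℝ` that dominates the transversal part of the shell integrals. -/
def transWeight (c t : ℝ) : ENNReal := decay (7 / 6) (t + c) + decay (7 / 6) t

@[fun_prop]
lemma measurable_transWeight (c : ℝ) : Measurable (transWeight c) := by
  unfold transWeight; fun_prop

lemma lintegral_transWeight (c : ℝ) :
    ∫⁻ t, transWeight c t = 2 * ∫⁻ t, decay (7 / 6) t := by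
  unfold transWeight
  rw [lintegral_add_left (by fun_prop), lintegral_decay_add, two_mul]

lemma norm_sq_insertNth {n : ℕ} (i : Fin (n + 1)) (x : ℝ) (y : Fin n → ℝ) :
    ‖(WithLp.toLp 2 (i.insertNth x y : Fin (n + 1) → ℝ) : Rn (n + 1))‖ ^ 2 =
      x ^ 2 + ∑ j, y j ^ 2 := by
  rw [EuclideanSpace.real_norm_sq_eq, Fin.sum_univ_succAbove _ i]
  simp

lemma abs_coord_le_norm (ξ : Rn 3) (i : Fin 3) : |ξ i| ≤ ‖ξ‖ := by
  simpa using PiLp.norm_apply_le ξ i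

/-- The part of the shell integrand in which the `i`-th coordinate dominates. -/
def shellTerm (c : Rn 3) (a : ℝ) (i : Fin 3) (η : Rn 3) : ENNReal :=
  decay (-(2 / 3)) (η i) * decay (9 / 10) (a - 2 * ‖η‖ ^ 2) *
    ∏ j : Fin 2, transWeight (c (i.succAbove j)) (η (i.succAbove j))

lemma measurable_shellTerm (c : Rn 3) (a : ℝ) (i : Fin 3) : Measurable (shellTerm c a i) := by
  unfold shellTerm
  simp only [Fin.prod_univ_two]
  have : ∀ j, Measurable fun η : Rn 3 ↦ η j := fun j ↦ by fun_prop
  fun_prop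

lemma shell_le_sum_shellTerm (c : Rn 3) (a : ℝ) (η : Rn 3) :
    decay (5 / 3) ‖η + c‖ * decay (9 / 10) (a - 2 * ‖η‖ ^ 2) ≤ ∑ i, shellTerm c a i η := by
  obtain ⟨i, hi⟩ : ∃ i, ∀ j, |η j| ≤ |η i| := Finite.exists_max fun j ↦ |η j|
  refine le_trans ?_ (Finset.single_le_sum (fun i _ ↦ zero_le) (Finset.mem_univ i))
  unfold shellTerm
  have h1 : decay (5 / 3) ‖η + c‖ ≤ ∏ j : Fin 2, decay (5 / 6) ((η + c) (i.succAbove j)) := by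
    have : (5 / 3 : ℝ) = 5 / 6 + 5 / 6 := by norm_num
    rw [Fin.prod_univ_two, this, ← decay_mul_decay]
    gcongr <;>
    · apply decay_anti_abs (by norm_num)
      rw [abs_norm]
      exact abs_coord_le_norm _ _
  have h2 : (1 : ENNReal) ≤
      decay (-(2 / 3)) (η i) * ∏ j : Fin 2, decay (1 / 3) (η (i.succAbove j)) := by
    calc (1 : ENNReal) = decay (-(2 / 3)) (η i) * ∏ j : Fin 2, decay (1 / 3) (η i) := by
          rw [Fin.prod_univ_two, decay_mul_decay, decay_mul_decay, decay]; norm_num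
      _ ≤ _ := by
          gcongr with j
          exact decay_anti_abs (by norm_num) (hi _)
  calc _ = decay (5 / 3) ‖η + c‖ * 1 * decay (9 / 10) (a - 2 * ‖η‖ ^ 2) := by rw [mul_one]
    _ ≤ (∏ j : Fin 2, decay (5 / 6) ((η + c) (i.succAbove j))) *
        (decay (-(2 / 3)) (η i) * ∏ j : Fin 2, decay (1 / 3) (η (i.succAbove j))) *
        decay (9 / 10) (a - 2 * ‖η‖ ^ 2) := by gcongr
    _ = decay (-(2 / 3)) (η i) * decay (9 / 10) (a - 2 * ‖η‖ ^ 2) *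
        ∏ j : Fin 2, (decay (5 / 6) ((η + c) (i.succAbove j)) *
          decay (1 / 3) (η (i.succAbove j))) := by
        rw [Finset.prod_mul_distrib]; ring
    _ ≤ _ := by
        gcongr with j
        have := decay_mul_decay_le (p := 5 / 6) (q := 1 / 3) (by norm_num) (by norm_num)
          (η (i.succAbove j) + c (i.succAbove j)) (η (i.succAbove j))
        norm_num at this
        simpa [transWeight] using this

lemma exists_lintegral_shell_le : ∃ C : ENNReal, C ≠ ⊤ ∧ ∀ (c : Rn 3) (a : ℝ),
    ∫⁻ η, decay (5 / 3) ‖η + c‖ * decay (9 / 10) (a - 2 * ‖η‖ ^ 2) ≤ C := by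
  obtain ⟨C, hC, hb⟩ := exists_lintegral_quadratic_decay_le
  have hI := (lintegral_decay_lt_top (r := 7 / 6) (by norm_num)).ne
  refine ⟨3 * (C * (2 * ∫⁻ t, decay (7 / 6) t) ^ 2), by finiteness, fun c a ↦ ?_⟩
  calc _ ≤ ∫⁻ η, ∑ i, shellTerm c a i η := lintegral_mono (shell_le_sum_shellTerm c a)
    _ = ∑ i, ∫⁻ η, shellTerm c a i η :=
        lintegral_finsetSum _ fun i _ ↦ measurable_shellTerm c a i
    _ ≤ ∑ _i : Fin 3, C * (2 * ∫⁻ t, decay (7 / 6) t) ^ 2 := by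
        gcongr with i
        rw [lintegral_eq_lintegral_insertNth i (measurable_shellTerm c a i)]
        calc _ ≤ ∫⁻ y : Fin 2 → ℝ, C * ∏ j : Fin 2, transWeight (c (i.succAbove j)) (y j) := by
              refine lintegral_mono fun y ↦ ?_
              unfold shellTerm
              simp only [Fin.insertNth_apply_same, Fin.insertNth_apply_succAbove]
              rw [lintegral_mul_const _ (by fun_prop)]
              gcongr
              refine le_trans (le_of_eq (lintegral_congr fun x ↦ ?_)) (hb (a - 2 * ∑ j, y j ^ 2))
              congr 2
              rw [norm_sq_insertNth i x y]
              ring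
          _ = _ := by
              rw [lintegral_const_mul _ (by simp only [Fin.prod_univ_two]; fun_prop),
                lintegral_fin_two_prod (fun j ↦ measurable_transWeight _)]
              simp [lintegral_transWeight]
    _ = _ := by simp

/-- The spatial frequency weight dominating `(|ξ| m_N(ξ))⁻²`. -/
def gradWeight (ξ : Rn 3) : ENNReal := lowWeight ξ + decay (5 / 3) ‖ξ‖

@[fun_prop]
lemma measurable_gradWeight : Measurable gradWeight := by
  unfold gradWeight; fun_prop

lemma exists_lintegral_paraboloid_le : ∃ C : ENNReal, C ≠ ⊤ ∧ ∀ (ξ : Rn 3) (τ : ℝ),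
    ∫⁻ η, gradWeight η * decay (9 / 10) (τ - ‖η‖ ^ 2 - ‖ξ - η‖ ^ 2) ≤ C := by
  obtain ⟨C, hC, hb⟩ := exists_lintegral_shell_le
  refine ⟨(∫⁻ ξ, lowWeight ξ) + C, by simp [hC, lintegral_lowWeight_lt_top.ne], fun ξ τ ↦ ?_⟩
  simp_rw [gradWeight, add_mul]
  rw [lintegral_add_left (by fun_prop)]
  gcongr ?_ + ?_
  · refine lintegral_mono fun η ↦ ?_
    exact mul_le_of_le_one_right' (decay_le_one (by norm_num))
  · rw [← lintegral_add_right_eq_self _ ((1 / 2 : ℝ) • ξ)]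
    refine le_trans (le_of_eq (lintegral_congr fun η ↦ ?_)) (hb ((1 / 2 : ℝ) • ξ)
      (τ - ‖ξ‖ ^ 2 / 2))
    congr 2
    have h1 : ‖η + (1 / 2 : ℝ) • ξ‖ ^ 2 = ‖η‖ ^ 2 + ⟪η, ξ⟫ + ‖ξ‖ ^ 2 / 4 := by
      rw [norm_add_sq_real, inner_smul_right, norm_smul, mul_pow]; norm_num; ring
    have h2 : ‖ξ - (η + (1 / 2 : ℝ) • ξ)‖ ^ 2 = ‖η‖ ^ 2 - ⟪η, ξ⟫ + ‖ξ‖ ^ 2 / 4 := by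
      have : ξ - (η + (1 / 2 : ℝ) • ξ) = (1 / 2 : ℝ) • ξ - η := by module
      rw [this, norm_sub_sq_real, inner_smul_left, norm_smul, mul_pow, real_inner_comm]
      norm_num; ring
    rw [h1, h2]; ring

lemma exists_lintegral_convolution_weight_le {p : ℝ} (hp : 1 < p) :
    ∃ C : ENNReal, C ≠ ⊤ ∧ ∀ (ξ : Rn 3) (τ : ℝ), ∫⁻ η, ∫⁻ σ,
      gradWeight η * decay p (σ - ‖η‖ ^ 2) * decay (9 / 10) (τ - σ - ‖ξ - η‖ ^ 2) ≤ C := by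
  obtain ⟨C, hC, hb⟩ := exists_lintegral_paraboloid_le
  have hI := (lintegral_decay_lt_top hp).ne
  refine ⟨ENNReal.ofReal (2 ^ (9 / 10 : ℝ)) * (2 * ∫⁻ x, decay p x) * C, by finiteness,
    fun ξ τ ↦ ?_⟩
  calc _ ≤ ∫⁻ η, ENNReal.ofReal (2 ^ (9 / 10 : ℝ)) * (2 * ∫⁻ x, decay p x) *
        (gradWeight η * decay (9 / 10) (τ - ‖η‖ ^ 2 - ‖ξ - η‖ ^ 2)) := by
        refine lintegral_mono fun η ↦ ?_
        simp_rw [mul_assoc (gradWeight η)]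
        rw [lintegral_const_mul _ (by fun_prop), mul_left_comm]
        gcongr
        have := lintegral_decay_conv_le (p := p) (r := 9 / 10) (by norm_num) (by linarith)
          (‖η‖ ^ 2) (τ - ‖ξ - η‖ ^ 2)
        simpa only [sub_right_comm] using this
    _ ≤ _ := by
        rw [lintegral_const_mul _ (by fun_prop)]
        gcongr
        exact hb ξ τ

/-- Cauchy–Schwarz for a convolution with weights `a`, `b` whose convolution is bounded. -/
lemma lintegral_convolution_sq_le {G : Type*} [MeasurableSpace G] [AddCommGroup G]
    [MeasurableAdd₂ G] [MeasurableNeg G] [MeasurableSub₂ G] {μ : Measure G} [SFinite μ]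
    [μ.IsAddLeftInvariant] [μ.IsNegInvariant]
    {f g a b A B : G → ENNReal} (ha : Measurable a)
    (hb : Measurable b) (hA : Measurable A) (hB : Measurable B)
    (hfa : ∀ᵐ x ∂μ, f x ^ 2 ≤ a x * A x) (hgb : ∀ᵐ x ∂μ, g x ^ 2 ≤ b x * B x)
    {S : ENNReal} (hS : ∀ x, ∫⁻ y, a y * b (x - y) ∂μ ≤ S) :
    ∫⁻ x, (∫⁻ y, f y * g (x - y) ∂μ) ^ 2 ∂μ ≤ S * ((∫⁻ x, A x ∂μ) * ∫⁻ x, B x ∂μ) := by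
  have key : ∀ x, (∫⁻ y, f y * g (x - y) ∂μ) ^ 2 ≤ S * ∫⁻ y, A y * B (x - y) ∂μ := by
    intro x
    have hgb' : ∀ᵐ y ∂μ, g (x - y) ^ 2 ≤ b (x - y) * B (x - y) :=
      (quasiMeasurePreserving_sub_left μ x).ae hgb
    have h1 : ∫⁻ y, f y * g (x - y) ∂μ ≤
        ∫⁻ y, (a y * b (x - y)) ^ (1 / 2 : ℝ) * (A y * B (x - y)) ^ (1 / 2 : ℝ) ∂μ := by
      refine lintegral_mono_ae ?_
      filter_upwards [hfa, hgb'] with y h1 h2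
      rw [← ENNReal.mul_rpow_of_nonneg _ _ (by norm_num)]
      rw [← ENNReal.rpow_le_rpow_iff (z := 2) (by norm_num), ← ENNReal.rpow_mul]
      norm_num
      calc (f y * g (x - y)) ^ 2 = f y ^ 2 * g (x - y) ^ 2 := mul_pow _ _ _
        _ ≤ (a y * A y) * (b (x - y) * B (x - y)) := by gcongr
        _ = _ := by ring
    have h2 := ENNReal.lintegral_mul_le_Lp_mul_Lq μ (p := 2) (q := 2)
      (Real.HolderConjugate.two_two)
      (f := fun y ↦ (a y * b (x - y)) ^ (1 / 2 : ℝ))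
      (g := fun y ↦ (A y * B (x - y)) ^ (1 / 2 : ℝ)) (by fun_prop) (by fun_prop)
    simp only [← ENNReal.rpow_mul] at h2
    norm_num at h2
    have h3 := h1.trans (le_of_eq_of_le (by simp) h2)
    calc _ ≤ _ := pow_le_pow_left' h3 2
      _ = (∫⁻ y, a y * b (x - y) ∂μ) * ∫⁻ y, A y * B (x - y) ∂μ := by
          rw [mul_pow, ← ENNReal.rpow_natCast, ← ENNReal.rpow_natCast, ← ENNReal.rpow_mul,
            ← ENNReal.rpow_mul]
          norm_num
      _ ≤ _ := by gcongr; exact hS x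
  calc _ ≤ ∫⁻ x, S * ∫⁻ y, A y * B (x - y) ∂μ ∂μ := lintegral_mono key
    _ = S * ∫⁻ x, ∫⁻ y, A y * B (x - y) ∂μ ∂μ := by
        rw [lintegral_const_mul]
        exact Measurable.lintegral_prod_right' (f := fun z : G × G ↦ A z.2 * B (z.1 - z.2))
          (by fun_prop)
    _ = S * ∫⁻ y, ∫⁻ x, A y * B (x - y) ∂μ ∂μ := by
        rw [lintegral_lintegral_swap]
        fun_prop
    _ = _ := by
        congr 1
        simp_rw [sub_eq_add_neg]
        rw [← lintegral_mul_const _ hA]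
        refine lintegral_congr fun y ↦ ?_
        rw [lintegral_const_mul _ (by fun_prop), lintegral_add_right_eq_self B]

section Plancherel

variable {V : Type*} [NormedAddCommGroup V] [InnerProductSpace ℝ V] [FiniteDimensional ℝ V]
  [MeasurableSpace V] [BorelSpace V]
  {H : Type*} [NormedAddCommGroup H] [InnerProductSpace ℂ H]

open SchwartzMap in
lemma ofReal_integral_norm_sq {F : Type*} [NormedAddCommGroup F] [NormedSpace ℝ F]
    (f : 𝓢(V, F)) : ENNReal.ofReal (∫ x, ‖f x‖ ^ 2) = ∫⁻ x, ‖f x‖ₑ ^ 2 := by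
  have hi : Integrable (fun x ↦ ‖f x‖ ^ 2) volume :=
    (f.memLp 2 volume).integrable_norm_pow (by norm_num)
  rw [ofReal_integral_eq_lintegral_ofReal hi (by filter_upwards with x using by positivity)]
  refine lintegral_congr fun x ↦ ?_
  rw [ENNReal.ofReal_pow (norm_nonneg _), ofReal_norm]

open SchwartzMap in
lemma lintegral_enorm_sq_fourier [CompleteSpace H] (f : 𝓢(V, H)) :
    ∫⁻ x, ‖𝓕 f x‖ₑ ^ 2 = ∫⁻ x, ‖f x‖ₑ ^ 2 := by
  rw [← ofReal_integral_norm_sq, ← ofReal_integral_norm_sq, integral_norm_sq_fourier]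

open SchwartzMap in
lemma fourierInv_apply_eq_fourier_neg (f : 𝓢(V, H)) (x : V) :
    𝓕⁻ f x = 𝓕 f (-x) := by
  rw [fourierInv_coe, fourier_coe, Real.fourierInv_eq_fourier_neg]

open SchwartzMap in
/-- The `L²` norm of a product is at most that of the convolution of the absolute values of the
Fourier transforms. -/
lemma lintegral_enorm_smul_sq_le [CompleteSpace H] (f : 𝓢(V, ℂ)) (g : 𝓢(V, H)) :
    ∫⁻ x, (‖f x‖ₑ * ‖g x‖ₑ) ^ 2 ≤ ∫⁻ x, (∫⁻ y, ‖𝓕 f y‖ₑ * ‖𝓕 g (x - y)‖ₑ) ^ 2 := by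
  set B := ContinuousLinearMap.lsmul ℂ ℂ (E := H)
  have h1 : 𝓕 (SchwartzMap.convolution B (𝓕⁻ f) (𝓕⁻ g)) = pairing B f g := by
    rw [fourier_convolution]; simp
  calc ∫⁻ x, (‖f x‖ₑ * ‖g x‖ₑ) ^ 2 = ∫⁻ x, ‖pairing B f g x‖ₑ ^ 2 := by
        refine lintegral_congr fun x ↦ ?_
        simp [B, pairing_apply_apply, enorm_smul]
    _ = ∫⁻ x, ‖SchwartzMap.convolution B (𝓕⁻ f) (𝓕⁻ g) x‖ₑ ^ 2 := by
        rw [← h1, lintegral_enorm_sq_fourier]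
    _ = ∫⁻ x, ‖SchwartzMap.convolution B (𝓕⁻ f) (𝓕⁻ g) (-x)‖ₑ ^ 2 :=
        (lintegral_neg_eq_self _).symm
    _ ≤ _ := by
        refine lintegral_mono fun x ↦ ?_
        gcongr
        rw [convolution_apply, MeasureTheory.convolution]
        refine (enorm_integral_le_lintegral_enorm _).trans (le_of_eq ?_)
        rw [← lintegral_neg_eq_self]
        refine lintegral_congr fun y ↦ ?_
        simp [B, enorm_smul, fourierInv_apply_eq_fourier_neg, sub_eq_add_neg, add_comm]

end Plancherel

/-- Space-time `ℝ³ × ℝ` with its Euclidean structure. -/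
abbrev Spt := WithLp 2 (Rn 3 × ℝ)

/-- The point of space-time with given space and time coordinates. -/
def spt (x : Rn 3) (t : ℝ) : Spt := WithLp.toLp 2 (x, t)

@[simp] lemma spt_fst (x : Rn 3) (t : ℝ) : (spt x t).fst = x := rfl

@[simp] lemma spt_snd (x : Rn 3) (t : ℝ) : (spt x t).snd = t := rfl

@[fun_prop]
lemma continuous_spt {X : Type*} [TopologicalSpace X] {f : X → Rn 3} {g : X → ℝ}
    (hf : Continuous f) (hg : Continuous g) : Continuous fun x ↦ spt (f x) (g x) := by
  unfold spt; fun_prop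

lemma measurePreserving_spt :
    MeasurePreserving (fun p : Rn 3 × ℝ ↦ spt p.1 p.2) :=
  WithLp.volume_preserving_toLp (Rn 3) ℝ

lemma measurableEmbedding_spt : MeasurableEmbedding (fun p : Rn 3 × ℝ ↦ spt p.1 p.2) :=
  (MeasurableEquiv.toLp 2 (Rn 3 × ℝ)).measurableEmbedding

lemma lintegral_spt {f : Spt → ENNReal} (hf : Measurable f) :
    ∫⁻ z, f z = ∫⁻ x, ∫⁻ t, f (spt x t) := by
  rw [← measurePreserving_spt.lintegral_comp hf, Measure.volume_eq_prod, lintegral_prod]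
  exact (hf.comp measurePreserving_spt.measurable).aemeasurable

lemma lintegral_spt_symm {f : Spt → ENNReal} (hf : Measurable f) :
    ∫⁻ z, f z = ∫⁻ t, ∫⁻ x, f (spt x t) := by
  rw [← measurePreserving_spt.lintegral_comp hf, Measure.volume_eq_prod, lintegral_prod_symm]
  exact (hf.comp measurePreserving_spt.measurable).aemeasurable

section

variable {E : Type*} [NormedAddCommGroup E]

lemma integrable_comp_spt {f : Spt → E} (hf : Integrable f) :
    Integrable (fun p : Rn 3 × ℝ ↦ f (spt p.1 p.2)) (volume.prod volume) :=
  measurePreserving_spt.integrable_comp_of_integrable hf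

lemma integral_spt [NormedSpace ℝ E] {f : Spt → E} (hf : Integrable f) :
    ∫ z, f z = ∫ x, ∫ t, f (spt x t) := by
  rw [← measurePreserving_spt.integral_comp measurableEmbedding_spt, Measure.volume_eq_prod,
    integral_prod _ (integrable_comp_spt hf)]

end

lemma inner_spt (x ξ : Rn 3) (t τ : ℝ) : ⟪spt x t, spt ξ τ⟫ = ⟪x, ξ⟫ + t * τ := by
  simp [spt, WithLp.prod_inner_apply, mul_comm]

open SchwartzMap in
lemma stFourier_eq_fourier {E : Type*} [NormedAddCommGroup E] [NormedSpace ℂ E]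
    (U : 𝓢(Spt, E)) (ξ : Rn 3) (τ : ℝ) :
    stFourier 3 (fun x t ↦ U (spt x t)) ξ τ = 𝓕 U (spt ξ τ) := by
  rw [fourier_coe, Real.fourier_eq, integral_spt]
  · unfold stFourier
    refine integral_congr_ae (.of_forall fun x ↦ integral_congr_ae (.of_forall fun t ↦ ?_))
    simp only
    rw [Circle.smul_def, Real.fourierChar_apply, inner_spt]
    congr 2
    push_cast; ring
  · exact (Real.fourierIntegral_convergent_iff (V := Spt) (spt ξ τ)).2 U.integrable

lemma japR_le (x : ℝ) : japR x ≤ 1 + |x| := by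
  unfold japR
  rw [Real.sqrt_le_left (by positivity)]
  nlinarith [abs_nonneg x, sq_abs x]

lemma one_le_japR (x : ℝ) : 1 ≤ japR x := by
  unfold japR
  rw [Real.one_le_sqrt]
  nlinarith [sq_nonneg x]

lemma one_add_abs_le_two_mul_japR (x : ℝ) : 1 + |x| ≤ 2 * japR x := by
  have h1 := one_le_japR x
  have h2 : |x| ≤ japR x := Real.abs_le_sqrt (by linarith)
  linarith

@[fun_prop]
lemma continuous_japR : Continuous japR := by unfold japR; fun_prop

/-- The modulation weight `⟨τ - |ξ|²⟩^{2b}`. -/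
def modWeight (b : ℝ) (z : Spt) : ℝ := japR (z.snd - ‖z.fst‖ ^ 2) ^ (2 * b)

@[fun_prop]
lemma continuous_modWeight (b : ℝ) : Continuous (modWeight b) := by
  unfold modWeight
  refine Continuous.rpow_const (by fun_prop) fun z ↦ Or.inl ?_
  linarith [one_le_japR (z.snd - ‖z.fst‖ ^ 2)]

lemma modWeight_nonneg (b : ℝ) (z : Spt) : 0 ≤ modWeight b z :=
  Real.rpow_nonneg (by linarith [one_le_japR (z.snd - ‖z.fst‖ ^ 2)]) _

lemma norm_spt_fst_le (z : Spt) : ‖z.fst‖ ≤ ‖z‖ := WithLp.norm_fst_le _ z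

lemma abs_snd_le (z : Spt) : |z.snd| ≤ ‖z‖ := WithLp.norm_snd_le _ z

lemma modWeight_le {b : ℝ} (hb : b ≤ 1) (z : Spt) : modWeight b z ≤ 8 * (1 + ‖z‖ ^ 4) := by
  have h1 := one_le_japR (z.snd - ‖z.fst‖ ^ 2)
  have hz := norm_nonneg z
  have h2 : japR (z.snd - ‖z.fst‖ ^ 2) ≤ (1 + ‖z‖) ^ 2 := by
    have ha : |z.snd - ‖z.fst‖ ^ 2| ≤ |z.snd| + ‖z.fst‖ ^ 2 :=
      (abs_sub _ _).trans (by simp)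
    nlinarith [japR_le (z.snd - ‖z.fst‖ ^ 2), norm_spt_fst_le z, abs_snd_le z, norm_nonneg z.fst]
  calc modWeight b z ≤ japR (z.snd - ‖z.fst‖ ^ 2) ^ (2 : ℝ) :=
        Real.rpow_le_rpow_of_exponent_le h1 (by linarith)
    _ ≤ ((1 + ‖z‖) ^ 2) ^ 2 := by
        rw [Real.rpow_two]; gcongr
    _ ≤ _ := by nlinarith [sq_nonneg (‖z‖ - 1), sq_nonneg (‖z‖ ^ 2 - 1), sq_nonneg (‖z‖ ^ 2 - ‖z‖)]

open SchwartzMap in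
lemma integrable_modWeight_mul {E : Type*} [NormedAddCommGroup E] [NormedSpace ℝ E]
    {b : ℝ} (hb : b ≤ 1) (f : 𝓢(Spt, E)) : Integrable fun z ↦ modWeight b z * ‖f z‖ ^ 2 := by
  have hi : Integrable fun z ↦ 8 * (‖f z‖ + ‖z‖ ^ 4 * ‖f z‖) * SchwartzMap.seminorm ℝ 0 0 f :=
    ((f.integrable.norm.add (f.integrable_pow_mul volume 4)).const_mul 8).mul_const _
  refine hi.mono' (by fun_prop) ?_
  filter_upwards with z
  have hM := norm_le_seminorm ℝ f z
  rw [Real.norm_of_nonneg (mul_nonneg (modWeight_nonneg b z) (by positivity))]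
  calc modWeight b z * ‖f z‖ ^ 2 = modWeight b z * ‖f z‖ * ‖f z‖ := by ring
    _ ≤ (8 * (1 + ‖z‖ ^ 4)) * ‖f z‖ * SchwartzMap.seminorm ℝ 0 0 f := by
        gcongr; exact modWeight_le hb z
    _ = _ := by ring

open SchwartzMap in
lemma ofReal_XNorm_sq {E : Type*} [NormedAddCommGroup E] [NormedSpace ℂ E]
    {b : ℝ} (hb : b ≤ 1) (U : 𝓢(Spt, E)) :
    ENNReal.ofReal (XNorm 3 0 b (fun x t ↦ U (spt x t))) ^ 2 =
      ∫⁻ z, ENNReal.ofReal (modWeight b z) * ‖𝓕 U z‖ₑ ^ 2 := by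
  have hi := integrable_modWeight_mul hb (𝓕 U)
  have h1 : XNorm 3 0 b (fun x t ↦ U (spt x t)) =
      (∫ z, modWeight b z * ‖𝓕 U z‖ ^ 2) ^ (1 / 2 : ℝ) := by
    rw [integral_spt hi]
    simp [XNorm, stFourier_eq_fourier, modWeight]
  have h0 : 0 ≤ ∫ z, modWeight b z * ‖𝓕 U z‖ ^ 2 :=
    integral_nonneg fun z ↦ mul_nonneg (modWeight_nonneg b z) (by positivity)
  rw [h1, ← ENNReal.ofReal_pow (by positivity), ← Real.rpow_natCast, ← Real.rpow_mul h0]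
  norm_num
  rw [ofReal_integral_eq_lintegral_ofReal hi (by
    filter_upwards with z using mul_nonneg (modWeight_nonneg b z) (by positivity))]
  refine lintegral_congr fun z ↦ ?_
  rw [ENNReal.ofReal_mul (modWeight_nonneg b z), ENNReal.ofReal_pow (norm_nonneg _),
    ofReal_norm]

/-- A Schwartz function on the product as one on Euclidean space-time. -/
def toSpt (φ : SchwartzMap (Rn 3 × ℝ) ℂ) : SchwartzMap Spt ℂ :=
  SchwartzMap.compCLMOfContinuousLinearEquiv ℂ (WithLp.prodContinuousLinearEquiv 2 ℝ (Rn 3) ℝ) φ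

lemma toSpt_spt (φ : SchwartzMap (Rn 3 × ℝ) ℂ) (x : Rn 3) (t : ℝ) :
    toSpt φ (spt x t) = φ (x, t) := rfl

lemma IsAdmissibleMultiplier.hasTemperateGrowth {n : ℕ} {s : ℝ} (hs : s < 1) {m₁ : Rn n → ℝ}
    (hm : IsAdmissibleMultiplier n s m₁) : m₁.HasTemperateGrowth := by
  obtain ⟨hsm, -, -, -, -, htail⟩ := hm
  refine ⟨hsm, fun k ↦ ?_⟩
  have hcont : Continuous (iteratedFDeriv ℝ k m₁) :=
    hsm.continuous_iteratedFDeriv (by exact_mod_cast le_top)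
  obtain ⟨M, hM⟩ := (isCompact_closedBall (0 : Rn n) 3).exists_bound_of_continuousOn
    hcont.continuousOn
  refine ⟨0, M, fun x ↦ ?_⟩
  rw [pow_zero, mul_one]
  rcases le_or_gt ‖x‖ 3 with hx | hx
  · exact hM x (by simpa using hx)
  set l := ‖x‖ / 3 with hl
  have hl1 : 1 < l := by rw [hl]; linarith
  have hl0 : 0 < l := by linarith
  have heq : m₁ =ᶠ[nhds x] fun y ↦ (l ^ (-(1 - s))) • m₁ (l⁻¹ • y) := by
    have : ∀ᶠ y in nhds x, 2 * l < ‖y‖ :=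
      continuous_norm.continuousAt.eventually_const_lt (by simp only [hl]; linarith)
    filter_upwards [this] with y hy
    have h1 : ‖l⁻¹ • y‖ = ‖y‖ / l := by
      rw [norm_smul, Real.norm_of_nonneg (by positivity)]; ring
    rw [htail y (by linarith), htail _ (by rw [h1, le_div_iff₀ hl0]; linarith), h1,
      smul_eq_mul, ← Real.mul_rpow hl0.le (by positivity)]
    congr 1; field_simp
  rw [(Filter.EventuallyEq.iteratedFDeriv ℝ heq k).eq_of_nhds, iteratedFDeriv_const_smul_apply',
    iteratedFDeriv_comp_const_smul]
  · have hx3 : ‖l⁻¹ • x‖ = 3 := by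
      rw [norm_smul, Real.norm_of_nonneg (by positivity), hl]; field_simp
    rw [norm_smul, norm_smul, Real.norm_of_nonneg (by positivity),
      Real.norm_of_nonneg (by positivity)]
    have hb := hM (l⁻¹ • x) (by simp [hx3])
    calc _ ≤ 1 * (1 * M) := by
          gcongr
          · exact Real.rpow_le_one_of_one_le_of_nonpos hl1.le (by linarith)
          · exact pow_le_one₀ (by positivity) (inv_le_one_of_one_le₀ hl1.le)
      _ = M := by ring
  · exact hsm.of_le (by exact_mod_cast le_top)
  · exact ((hsm.comp (contDiff_const_smul _)).of_le (by exact_mod_cast le_top)).contDiffAt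

lemma IsAdmissibleMultiplier.hasTemperateGrowth_mN {n : ℕ} {s : ℝ} (hs : s < 1)
    {m₁ : Rn n → ℝ} (hm : IsAdmissibleMultiplier n s m₁) (N : ℝ) :
    (mN m₁ N).HasTemperateGrowth :=
  (hm.hasTemperateGrowth hs).comp
    ((N⁻¹ • ContinuousLinearMap.id ℝ (Rn n)).hasTemperateGrowth)

/-- The multiplier `m_N`, as a complex function on space-time. -/
def mNC (m₁ : Rn 3 → ℝ) (N : ℝ) (z : Spt) : ℂ := (mN m₁ N z.fst : ℂ)

lemma IsAdmissibleMultiplier.hasTemperateGrowth_mNC {s : ℝ} (hs : s < 1) {m₁ : Rn 3 → ℝ}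
    (hm : IsAdmissibleMultiplier 3 s m₁) (N : ℝ) : (mNC m₁ N).HasTemperateGrowth :=
  Function.Complex.hasTemperateGrowth_ofReal.comp ((hm.hasTemperateGrowth_mN hs N).comp
    (WithLp.fstL 2 ℝ (Rn 3) ℝ).hasTemperateGrowth)

section Slices

open SchwartzMap

lemma exists_norm_le_one_add_norm_rpow (W : 𝓢(Spt, ℂ)) (k : ℕ) :
    ∃ C : ℝ, 0 ≤ C ∧ ∀ z, ‖W z‖ ≤ C * (1 + ‖z‖) ^ (-(k : ℝ)) := by
  refine ⟨2 ^ k * ((Finset.Iic (k, 0)).sup fun m ↦ SchwartzMap.seminorm ℝ m.1 m.2) W,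
    by positivity, fun z ↦ ?_⟩
  have h := one_add_le_sup_seminorm_apply (𝕜 := ℝ) (m := (k, 0)) le_rfl le_rfl W z
  rw [norm_iteratedFDeriv_zero, mul_comm] at h
  rw [Real.rpow_neg (by positivity), Real.rpow_natCast, ← div_eq_mul_inv,
    le_div_iff₀ (by positivity)]
  exact h

lemma norm_le_norm_spt_left (x : Rn 3) (t : ℝ) : ‖x‖ ≤ ‖spt x t‖ := norm_spt_fst_le (spt x t)

lemma abs_le_norm_spt_right (x : Rn 3) (t : ℝ) : |t| ≤ ‖spt x t‖ := abs_snd_le (spt x t)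

lemma integrable_slice_left (W : 𝓢(Spt, ℂ)) (t : ℝ) : Integrable fun x ↦ W (spt x t) := by
  obtain ⟨C, hC0, hC⟩ := exists_norm_le_one_add_norm_rpow W 4
  have hi : Integrable (fun x : Rn 3 ↦ (1 + ‖x‖) ^ (-((4 : ℕ) : ℝ))) volume :=
    integrable_one_add_norm (by simp; norm_num)
  refine (hi.const_mul C).mono' (by fun_prop) (.of_forall fun x ↦ (hC _).trans ?_)
  refine mul_le_mul_of_nonneg_left (Real.rpow_le_rpow_of_nonpos (by positivity) ?_ (by simp)) hC0
  gcongr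
  exact norm_le_norm_spt_left x t

/-- The inverse Fourier transform in the time frequency. -/
def timeFourierInv (W : Spt → ℂ) (t : ℝ) (ξ : Rn 3) : ℂ :=
  ∫ τ : ℝ, (Real.fourierChar (τ * t) : ℂ) * W (spt ξ τ)

lemma timeFourierInv_smul (g : Rn 3 → ℂ) (W : Spt → ℂ) (t : ℝ) (ξ : Rn 3) :
    timeFourierInv (fun z ↦ g z.fst * W z) t ξ = g ξ * timeFourierInv W t ξ := by
  unfold timeFourierInv
  rw [← integral_const_mul]
  congr! 2 with τ
  simp; ring

lemma continuous_timeFourierInv (W : 𝓢(Spt, ℂ)) (t : ℝ) : Continuous (timeFourierInv W t) := by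
  obtain ⟨C, hC0, hC⟩ := exists_norm_le_one_add_norm_rpow W 2
  have hi : Integrable (fun τ : ℝ ↦ (1 + ‖τ‖) ^ (-((2 : ℕ) : ℝ))) volume :=
    integrable_one_add_norm (by simp)
  refine continuous_of_dominated (bound := fun τ ↦ C * (1 + ‖τ‖) ^ (-((2 : ℕ) : ℝ)))
    (fun ξ ↦ by fun_prop) (fun ξ ↦ .of_forall fun τ ↦ ?_) (hi.const_mul _)
    (.of_forall fun τ ↦ by fun_prop)
  rw [norm_mul, Circle.norm_coe, one_mul]
  refine (hC _).trans ?_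
  refine mul_le_mul_of_nonneg_left (Real.rpow_le_rpow_of_nonpos (by positivity) ?_ (by simp)) hC0
  gcongr
  exact abs_le_norm_spt_right ξ τ

lemma integrable_timeFourierInv (W : 𝓢(Spt, ℂ)) (t : ℝ) : Integrable (timeFourierInv W t) := by
  have h : Integrable (fun z : Spt ↦ (Real.fourierChar (z.snd * t) : ℂ) * W z) := by
    refine W.integrable.norm.mono' (by fun_prop) (.of_forall fun z ↦ ?_)
    rw [norm_mul, Circle.norm_coe, one_mul]
  exact (integrable_comp_spt h).integral_prod_left

lemma fourierInv_eq_fourierInv_timeFourierInv (W : 𝓢(Spt, ℂ)) (x : Rn 3) (t : ℝ) :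
    𝓕⁻ W (spt x t) = 𝓕⁻ (timeFourierInv W t) x := by
  rw [fourierInv_coe, Real.fourierInv_eq, Real.fourierInv_eq, integral_spt]
  · refine integral_congr_ae (.of_forall fun ξ ↦ ?_)
    simp only [timeFourierInv, Circle.smul_def, smul_eq_mul]
    rw [← integral_const_mul]
    refine integral_congr_ae (.of_forall fun τ ↦ ?_)
    simp only [inner_spt, AddChar.map_add_eq_mul, Circle.coe_mul]
    ring
  · refine W.integrable.norm.mono' (by fun_prop) (.of_forall fun z ↦ ?_)
    simp [Circle.norm_smul]

lemma fourier_slice (Φ : 𝓢(Spt, ℂ)) (t : ℝ) :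
    𝓕 (fun x ↦ Φ (spt x t)) = timeFourierInv (𝓕 Φ : 𝓢(Spt, ℂ)) t := by
  have h1 : (fun x ↦ Φ (spt x t)) = 𝓕⁻ (timeFourierInv (𝓕 Φ : 𝓢(Spt, ℂ)) t) := by
    ext x
    rw [← fourierInv_eq_fourierInv_timeFourierInv]; simp
  have hi : Integrable (𝓕⁻ (timeFourierInv (𝓕 Φ : 𝓢(Spt, ℂ)) t)) := by
    rw [← h1]; exact integrable_slice_left Φ t
  rw [h1]
  refine Continuous.fourier_fourierInv_eq (continuous_timeFourierInv _ t)
    (integrable_timeFourierInv _ t) ?_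
  refine hi.comp_neg.congr (.of_forall fun ξ ↦ ?_)
  simp [Real.fourierInv_eq_fourier_neg]

/-- `I_N` acting on space-time Schwartz functions. -/
def sptIop (m₁ : Rn 3 → ℝ) (N : ℝ) (Φ : 𝓢(Spt, ℂ)) : 𝓢(Spt, ℂ) :=
  𝓕⁻ (smulLeftCLM ℂ (mNC m₁ N) (𝓕 Φ))

lemma Iop_slice {s : ℝ} (hs : s < 1) {m₁ : Rn 3 → ℝ} (hm : IsAdmissibleMultiplier 3 s m₁)
    (N : ℝ) (Φ : 𝓢(Spt, ℂ)) (x : Rn 3) (t : ℝ) :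
    Iop m₁ N (fun y ↦ Φ (spt y t)) x = sptIop m₁ N Φ (spt x t) := by
  rw [sptIop, fourierInv_eq_fourierInv_timeFourierInv, Iop, fourier_slice]
  refine congrArg (fun h : Rn 3 → ℂ ↦ 𝓕⁻ h x) (funext fun ξ ↦ ?_)
  rw [← timeFourierInv_smul (fun ξ ↦ (mN m₁ N ξ : ℂ))]
  refine congrArg (fun W ↦ timeFourierInv W t ξ) (funext fun z ↦ ?_)
  rw [smulLeftCLM_apply_apply (hm.hasTemperateGrowth_mNC hs N)]
  rfl

/-- The space-time direction of the `i`-th space coordinate. -/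
def spaceDir (i : Fin 3) : Spt := spt (EuclideanSpace.single i 1) 0

open LineDeriv in
/-- The spatial gradient of a space-time Schwartz function. -/
def spaceGrad (K : 𝓢(Spt, ℂ)) : 𝓢(Spt, EuclideanSpace ℂ (Fin 3)) :=
  ∑ i, postcompCLM ((1 : ℂ →L[ℂ] ℂ).smulRight (EuclideanSpace.single i (1 : ℂ)))
    (∂_{spaceDir i} K)

open LineDeriv in
lemma spaceGrad_apply (K : 𝓢(Spt, ℂ)) (z : Spt) (i : Fin 3) :
    spaceGrad K z i = ∂_{spaceDir i} K z := by
  simp [spaceGrad, Finset.sum_apply, Pi.single_apply]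

lemma gradC_slice (K : 𝓢(Spt, ℂ)) (x : Rn 3) (t : ℝ) :
    gradC (fun y ↦ K (spt y t)) x = spaceGrad K (spt x t) := by
  ext i
  rw [spaceGrad_apply, lineDerivOp_apply_eq_fderiv]
  have h1 : HasFDerivAt (fun y : Rn 3 ↦ spt y t)
      ((WithLp.prodContinuousLinearEquiv 2 ℝ (Rn 3) ℝ).symm.toContinuousLinearMap ∘L
        ContinuousLinearMap.inl ℝ (Rn 3) ℝ) x :=
    (WithLp.prodContinuousLinearEquiv 2 ℝ (Rn 3) ℝ).symm.hasFDerivAt.comp x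
      (hasFDerivAt_prodMk_left x t)
  have h2 := K.differentiableAt.hasFDerivAt.comp x h1
  simp only [gradC]
  change fderiv ℝ (K ∘ fun y ↦ spt y t) x _ = _
  rw [h2.fderiv]
  rfl

open LineDeriv in
lemma fourier_spaceGrad_apply (K : 𝓢(Spt, ℂ)) (z : Spt) (i : Fin 3) :
    𝓕 (spaceGrad K) z i = (2 * Real.pi * I) * (z.fst i * 𝓕 K z) := by
  have h1 : 𝓕 (spaceGrad K) z i = 𝓕 (∂_{spaceDir i} K) z := by
    rw [fourier_coe, fourier_coe, Real.fourier_eq, Real.fourier_eq]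
    have := (EuclideanSpace.proj (𝕜 := ℂ) i).integral_comp_comm
      ((Real.fourierIntegral_convergent_iff (V := Spt) z).2 ((spaceGrad K).integrable (μ := volume)))
    refine Eq.trans this.symm (integral_congr_ae (.of_forall fun v ↦ ?_))
    simp [Circle.smul_def, spaceGrad_apply]
  rw [h1, fourier_lineDerivOp_eq]
  rw [smul_apply, smulLeftCLM_apply_apply (by fun_prop)]
  simp [spaceDir, WithLp.prod_inner_apply, spt, EuclideanSpace.inner_single_right]

lemma norm_fourier_spaceGrad_sptIop {s : ℝ} (hs : s < 1) {m₁ : Rn 3 → ℝ}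
    (hm : IsAdmissibleMultiplier 3 s m₁) (N : ℝ) (Φ : 𝓢(Spt, ℂ)) (z : Spt) :
    ‖𝓕 (spaceGrad (sptIop m₁ N Φ)) z‖ =
      2 * Real.pi * (‖z.fst‖ * mN m₁ N z.fst) * ‖𝓕 Φ z‖ := by
  have h0 : 0 < mN m₁ N z.fst := (hm.2.1 _).1
  have h1 : 𝓕 (sptIop m₁ N Φ) z = mN m₁ N z.fst * 𝓕 Φ z := by
    simp [sptIop, smulLeftCLM_apply_apply (hm.hasTemperateGrowth_mNC hs N), mNC]
  rw [← pow_left_inj₀ (by positivity) (by positivity) two_ne_zero, EuclideanSpace.norm_sq_eq]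
  simp only [fourier_spaceGrad_apply, h1, norm_mul, norm_real, mul_pow, ← Finset.mul_sum,
    ← Finset.sum_mul, EuclideanSpace.real_norm_sq_eq, norm_I, Real.norm_eq_abs, sq_abs]
  norm_num
  ring

end Slices

section Bilinear

lemma IsAdmissibleMultiplier.rpow_le {n : ℕ} {s : ℝ} {m₁ : Rn n → ℝ}
    (hm : IsAdmissibleMultiplier n s m₁) {η : Rn n} (hη : 1 ≤ ‖η‖) :
    (2 * ‖η‖) ^ (-(1 - s)) ≤ m₁ η := by
  have h2 : ‖(2 : ℝ) • η‖ = 2 * ‖η‖ := by simp [norm_smul]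
  rw [← h2, ← hm.2.2.2.2.2 _ (by rw [h2]; linarith)]
  exact hm.2.2.2.1 _ _ (by rw [h2]; linarith)

lemma norm_inv_smul_of_one_le {n : ℕ} {N : ℝ} (hN : 1 ≤ N) (ξ : Rn n) :
    ‖N⁻¹ • ξ‖ = ‖ξ‖ / N := by
  rw [norm_smul, Real.norm_of_nonneg (by positivity), div_eq_inv_mul]

lemma mN_eq_one {n : ℕ} {s : ℝ} {m₁ : Rn n → ℝ} (hm : IsAdmissibleMultiplier n s m₁)
    {N : ℝ} (hN : 1 ≤ N) {ξ : Rn n} (hξ : ‖ξ‖ ≤ N) : mN m₁ N ξ = 1 :=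
  hm.2.2.2.2.1 _ (by rw [norm_inv_smul_of_one_le hN]; exact div_le_one_of_le₀ hξ (by linarith))

lemma rpow_le_norm_mul_mN {n : ℕ} {s : ℝ} (hs0 : 5 / 6 < s) (hs : s < 1) {m₁ : Rn n → ℝ}
    (hm : IsAdmissibleMultiplier n s m₁) {N : ℝ} (hN : 1 ≤ N) {ξ : Rn n} (hξ : 1 ≤ ‖ξ‖) :
    ‖ξ‖ ^ (5 / 6 : ℝ) / 2 ≤ ‖ξ‖ * mN m₁ N ξ := by
  have h0 : 0 < ‖ξ‖ := by linarith
  have hm' : (2 * ‖ξ‖) ^ (-(1 / 6) : ℝ) ≤ mN m₁ N ξ := by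
    rcases le_total ‖ξ‖ N with h | h
    · rw [mN_eq_one hm hN h]
      exact Real.rpow_le_one_of_one_le_of_nonpos (by linarith) (by norm_num)
    · have hη : 1 ≤ ‖N⁻¹ • ξ‖ := by
        rw [norm_inv_smul_of_one_le hN, le_div_iff₀ (by linarith)]; linarith
      have hle : ‖N⁻¹ • ξ‖ ≤ ‖ξ‖ := by
        rw [norm_inv_smul_of_one_le hN]; exact div_le_self h0.le hN
      calc (2 * ‖ξ‖) ^ (-(1 / 6) : ℝ) ≤ (2 * ‖N⁻¹ • ξ‖) ^ (-(1 / 6) : ℝ) :=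
            Real.rpow_le_rpow_of_nonpos (by linarith) (by linarith) (by norm_num)
        _ ≤ (2 * ‖N⁻¹ • ξ‖) ^ (-(1 - s)) :=
            Real.rpow_le_rpow_of_exponent_le (by linarith) (by linarith)
        _ ≤ _ := hm.rpow_le hη
  calc ‖ξ‖ ^ (5 / 6 : ℝ) / 2 = ‖ξ‖ * ((2 : ℝ) ^ (-1 : ℝ) * ‖ξ‖ ^ (-(1 / 6) : ℝ)) := by
        rw [show (5 / 6 : ℝ) = 1 + -(1 / 6) by norm_num, Real.rpow_add h0, Real.rpow_one,
          Real.rpow_neg_one]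
        ring
    _ ≤ ‖ξ‖ * ((2 : ℝ) ^ (-(1 / 6) : ℝ) * ‖ξ‖ ^ (-(1 / 6) : ℝ)) := by
        gcongr <;> norm_num
    _ = ‖ξ‖ * (2 * ‖ξ‖) ^ (-(1 / 6) : ℝ) := by rw [Real.mul_rpow (by norm_num) h0.le]
    _ ≤ _ := by gcongr

lemma one_le_gradWeight_mul {s : ℝ} (hs0 : 5 / 6 < s) (hs : s < 1) {m₁ : Rn 3 → ℝ}
    (hm : IsAdmissibleMultiplier 3 s m₁) {N : ℝ} (hN : 1 ≤ N) {ξ : Rn 3} (hξ : ξ ≠ 0) :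
    1 ≤ 16 * (gradWeight ξ * ENNReal.ofReal ((‖ξ‖ * mN m₁ N ξ) ^ 2)) := by
  have h0 : 0 < ‖ξ‖ := norm_pos_iff.2 hξ
  rcases lt_or_ge ‖ξ‖ 1 with h | h
  · rw [mN_eq_one hm hN (h.le.trans hN), mul_one]
    calc (1 : ENNReal) = lowWeight ξ * ENNReal.ofReal (‖ξ‖ ^ 2) := by
          rw [lowWeight, indicator_of_mem (by simpa using h), ← ENNReal.ofReal_mul (by positivity),
            inv_mul_cancel₀ (by positivity), ENNReal.ofReal_one]
      _ ≤ gradWeight ξ * ENNReal.ofReal (‖ξ‖ ^ 2) := by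
          gcongr; exact le_self_add
      _ ≤ _ := le_mul_of_one_le_left zero_le (by norm_num)
  · have key : 1 ≤ 16 * ((1 + ‖ξ‖) ^ (-(5 / 3) : ℝ) * (‖ξ‖ * mN m₁ N ξ) ^ 2) := by
      have h1 := rpow_le_norm_mul_mN hs0 hs hm hN h
      have h2 : (1 / 4) * ‖ξ‖ ^ (-(5 / 3) : ℝ) ≤ (1 + ‖ξ‖) ^ (-(5 / 3) : ℝ) := by
        calc (1 / 4) * ‖ξ‖ ^ (-(5 / 3) : ℝ)
            = (2 : ℝ) ^ (-2 : ℝ) * ‖ξ‖ ^ (-(5 / 3) : ℝ) := by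
              norm_num [Real.rpow_neg]
          _ ≤ (2 : ℝ) ^ (-(5 / 3) : ℝ) * ‖ξ‖ ^ (-(5 / 3) : ℝ) := by
              gcongr <;> norm_num
          _ = (2 * ‖ξ‖) ^ (-(5 / 3) : ℝ) := by rw [Real.mul_rpow (by norm_num) h0.le]
          _ ≤ _ := Real.rpow_le_rpow_of_nonpos (by positivity) (by linarith) (by norm_num)
      have h3 : ‖ξ‖ ^ (-(5 / 3) : ℝ) * (‖ξ‖ ^ (5 / 6 : ℝ)) ^ 2 = 1 := by
        rw [← Real.rpow_natCast, ← Real.rpow_mul h0.le, ← Real.rpow_add h0]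
        norm_num
      calc (1 : ℝ) = 16 * (((1 / 4) * ‖ξ‖ ^ (-(5 / 3) : ℝ)) * (‖ξ‖ ^ (5 / 6 : ℝ) / 2) ^ 2) := by
            linear_combination -h3
        _ ≤ _ := by gcongr
    calc (1 : ENNReal) ≤ ENNReal.ofReal
          (16 * ((1 + ‖ξ‖) ^ (-(5 / 3) : ℝ) * (‖ξ‖ * mN m₁ N ξ) ^ 2)) := by
          rwa [← ENNReal.ofReal_one, ENNReal.ofReal_le_ofReal_iff (by positivity)]
      _ = 16 * (decay (5 / 3) ‖ξ‖ * ENNReal.ofReal ((‖ξ‖ * mN m₁ N ξ) ^ 2)) := by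
          rw [ENNReal.ofReal_mul (by norm_num), ENNReal.ofReal_mul (by positivity), decay, abs_norm]
          norm_num
      _ ≤ _ := by
          gcongr; exact le_add_self

lemma one_le_decay_mul_modWeight {r b : ℝ} (hr0 : 0 ≤ r) (hr : r ≤ 2) (hb : r ≤ 2 * b) (z : Spt) :
    1 ≤ 4 * (decay r (z.snd - ‖z.fst‖ ^ 2) * ENNReal.ofReal (modWeight b z)) := by
  rw [modWeight]
  set x := z.snd - ‖z.fst‖ ^ 2
  have h1 := one_le_japR x
  have key : 1 ≤ 4 * ((1 + |x|) ^ (-r) * japR x ^ (2 * b)) := by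
    calc (1 : ℝ) = 4 * ((2 : ℝ) ^ (-2 : ℝ) * (japR x ^ (-r) * japR x ^ r)) := by
          rw [← Real.rpow_add (by linarith)]; norm_num [Real.rpow_neg]
      _ ≤ 4 * ((2 : ℝ) ^ (-r) * (japR x ^ (-r) * japR x ^ (2 * b))) := by
          gcongr; linarith
      _ = 4 * ((2 * japR x) ^ (-r) * japR x ^ (2 * b)) := by
          rw [Real.mul_rpow (by norm_num) (by linarith)]; ring
      _ ≤ _ := by
          gcongr 4 * (?_ * _)
          exact Real.rpow_le_rpow_of_nonpos (by positivity) (one_add_abs_le_two_mul_japR x)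
            (by linarith)
  calc (1 : ENNReal) ≤ ENNReal.ofReal (4 * ((1 + |x|) ^ (-r) * japR x ^ (2 * b))) := by
        rwa [← ENNReal.ofReal_one, ENNReal.ofReal_le_ofReal_iff (by positivity)]
    _ = _ := by
        rw [ENNReal.ofReal_mul (by norm_num), ENNReal.ofReal_mul (by positivity), decay]
        norm_num

lemma exists_lintegral_convolution_spt_le {p : ℝ} (hp : 1 < p) :
    ∃ C : ENNReal, C ≠ ⊤ ∧ ∀ z : Spt, ∫⁻ y : Spt,
      (gradWeight y.fst * decay p (y.snd - ‖y.fst‖ ^ 2)) *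
        decay (9 / 10) ((z - y).snd - ‖(z - y).fst‖ ^ 2) ≤ C := by
  obtain ⟨C, hC, h⟩ := exists_lintegral_convolution_weight_le hp
  refine ⟨C, hC, fun z ↦ ?_⟩
  rw [lintegral_spt (by fun_prop)]
  exact h z.fst z.snd

lemma ae_fst_ne_zero : ∀ᵐ z : Spt, z.fst ≠ 0 := by
  have h : ∀ᵐ p : Rn 3 × ℝ, p.1 ≠ 0 :=
    Measure.quasiMeasurePreserving_fst.ae (Measure.ae_ne volume 0)
  exact (WithLp.volume_preserving_ofLp (Rn 3) ℝ).quasiMeasurePreserving.ae h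

open SchwartzMap in
/-- The bilinear `L²` estimate: the factor `Φ` is measured through `∇ I_N Φ`. -/
lemma exists_bilinear_le {s : ℝ} (hs0 : 5 / 6 < s) (hs : s < 1) {m₁ : Rn 3 → ℝ}
    (hm : IsAdmissibleMultiplier 3 s m₁) {b : ℝ} (hb : 1 / 2 < b) (hb1 : b ≤ 1) :
    ∃ C : ENNReal, C ≠ ⊤ ∧ ∀ N : ℝ, 1 ≤ N → ∀ {H : Type} [NormedAddCommGroup H]
      [InnerProductSpace ℂ H] [CompleteSpace H] (Φ : 𝓢(Spt, ℂ)) (g : 𝓢(Spt, H)) (b' : ℝ),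
      9 / 20 ≤ b' → b' ≤ 1 →
      ∫⁻ z, (‖Φ z‖ₑ * ‖g z‖ₑ) ^ 2 ≤ C *
        (ENNReal.ofReal
            (XNorm 3 0 b (fun x t ↦ spaceGrad (sptIop m₁ N Φ) (spt x t))) ^ 2 *
          ENNReal.ofReal (XNorm 3 0 b' (fun x t ↦ g (spt x t))) ^ 2) := by
  obtain ⟨S, hS, hconv⟩ := exists_lintegral_convolution_spt_le (p := 2 * b) (by linarith)
  refine ⟨S * (16 * 4 * 4), by finiteness, fun N hN H _ _ _ Φ g b' hb' hb1' ↦ ?_⟩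
  set G := spaceGrad (sptIop m₁ N Φ) with hG
  refine (lintegral_enorm_smul_sq_le Φ g).trans ?_
  have hf : ∀ᵐ z : Spt, ‖𝓕 Φ z‖ₑ ^ 2 ≤
      (gradWeight z.fst * decay (2 * b) (z.snd - ‖z.fst‖ ^ 2)) *
        (16 * 4 * (ENNReal.ofReal (modWeight b z) * ‖𝓕 G z‖ₑ ^ 2)) := by
    filter_upwards [ae_fst_ne_zero] with z hz
    have h1 := one_le_gradWeight_mul hs0 hs hm hN hz
    have h2 := one_le_decay_mul_modWeight (r := 2 * b) (by linarith) (by linarith) le_rfl z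
    have hpos : 0 ≤ ‖z.fst‖ * mN m₁ N z.fst := mul_nonneg (norm_nonneg _) (hm.2.1 _).1.le
    have h3 : ENNReal.ofReal ((‖z.fst‖ * mN m₁ N z.fst) ^ 2) * ‖𝓕 Φ z‖ₑ ^ 2 ≤ ‖𝓕 G z‖ₑ ^ 2 := by
      rw [← ofReal_norm, ← ofReal_norm, ← ENNReal.ofReal_pow (norm_nonneg _),
        ← ENNReal.ofReal_pow (norm_nonneg _), ← ENNReal.ofReal_mul (by positivity),
        hG, norm_fourier_spaceGrad_sptIop hs hm, ← mul_pow]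
      refine ENNReal.ofReal_le_ofReal (pow_le_pow_left₀ (by positivity)
        (mul_le_mul_of_nonneg_right ?_ (norm_nonneg _)) 2)
      exact le_mul_of_one_le_left hpos (by linarith [Real.pi_gt_three])
    calc ‖𝓕 Φ z‖ₑ ^ 2 = 1 * 1 * ‖𝓕 Φ z‖ₑ ^ 2 := by simp
      _ ≤ (16 * (gradWeight z.fst * ENNReal.ofReal ((‖z.fst‖ * mN m₁ N z.fst) ^ 2))) *
          (4 * (decay (2 * b) (z.snd - ‖z.fst‖ ^ 2) * ENNReal.ofReal (modWeight b z))) *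
          ‖𝓕 Φ z‖ₑ ^ 2 := by gcongr
      _ = (gradWeight z.fst * decay (2 * b) (z.snd - ‖z.fst‖ ^ 2)) *
          (16 * 4 * (ENNReal.ofReal (modWeight b z) *
            (ENNReal.ofReal ((‖z.fst‖ * mN m₁ N z.fst) ^ 2) * ‖𝓕 Φ z‖ₑ ^ 2))) := by ring
      _ ≤ _ := by gcongr
  have hg : ∀ᵐ z : Spt, ‖𝓕 g z‖ₑ ^ 2 ≤ decay (9 / 10) (z.snd - ‖z.fst‖ ^ 2) *
        (4 * (ENNReal.ofReal (modWeight b' z) * ‖𝓕 g z‖ₑ ^ 2)) := by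
    filter_upwards with z
    have h2 := one_le_decay_mul_modWeight (r := 9 / 10) (b := b') (by norm_num) (by norm_num)
      (by linarith) z
    calc ‖𝓕 g z‖ₑ ^ 2 = 1 * ‖𝓕 g z‖ₑ ^ 2 := by simp
      _ ≤ (4 * (decay (9 / 10) (z.snd - ‖z.fst‖ ^ 2) * ENNReal.ofReal (modWeight b' z))) *
          ‖𝓕 g z‖ₑ ^ 2 := by gcongr
      _ = _ := by ring
  have hmF : Measurable fun z ↦ ‖𝓕 G z‖ₑ := (𝓕 G).continuous.enorm.measurable
  have hmg : Measurable fun z ↦ ‖𝓕 g z‖ₑ := (𝓕 g).continuous.enorm.measurable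
  have hmb : ∀ b, Measurable (modWeight b) := fun b ↦ (continuous_modWeight b).measurable
  refine (lintegral_convolution_sq_le (by fun_prop) (by fun_prop) (by fun_prop) (by fun_prop)
    hf hg hconv).trans (le_of_eq ?_)
  rw [lintegral_const_mul _ (by fun_prop), lintegral_const_mul _ (by fun_prop),
    ofReal_XNorm_sq hb1, ofReal_XNorm_sq hb1']
  ring

end Bilinear

section Quadrilinear

lemma XNorm_nonneg {n : ℕ} {E : Type*} [NormedAddCommGroup E] [NormedSpace ℂ E] (b : ℝ)
    (ψ : Rn n → ℝ → E) : 0 ≤ XNorm n 0 b ψ := by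
  refine Real.rpow_nonneg (integral_nonneg fun ξ ↦ integral_nonneg fun τ ↦ ?_) _
  have h1 : 0 ≤ jap ξ := Real.sqrt_nonneg _
  have h2 : 0 ≤ japR (τ - ‖ξ‖ ^ 2) := Real.sqrt_nonneg _
  dsimp only
  positivity

lemma ofReal_integral_integral_norm_le {E : Type*} [NormedAddCommGroup E] (F : Rn 3 → ℝ → E) :
    ENNReal.ofReal (∫ t, ∫ x, ‖F x t‖) ≤ ∫⁻ t, ∫⁻ x, ‖F x t‖ₑ := by
  refine (Real.ofReal_le_enorm _).trans ((enorm_integral_le_lintegral_enorm _).trans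
    (lintegral_mono fun t ↦ (enorm_integral_le_lintegral_enorm _).trans (le_of_eq ?_)))
  simp

lemma lintegral_mul_le_of_sq_le {α : Type*} [MeasurableSpace α] {μ : Measure α}
    {f g : α → ENNReal} (hf : AEMeasurable f μ) (hg : AEMeasurable g μ) {A B : ENNReal}
    (hA : ∫⁻ x, f x ^ 2 ∂μ ≤ A ^ 2) (hB : ∫⁻ x, g x ^ 2 ∂μ ≤ B ^ 2) :
    ∫⁻ x, f x * g x ∂μ ≤ A * B := by
  have hsq : ∀ a : ENNReal, (a ^ 2) ^ (1 / 2 : ℝ) = a := fun a ↦ by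
    rw [← ENNReal.rpow_natCast, ← ENNReal.rpow_mul]; norm_num
  refine (ENNReal.lintegral_mul_le_Lp_mul_Lq μ Real.HolderConjugate.two_two hf hg).trans ?_
  simp only [ENNReal.rpow_two]
  refine mul_le_mul' ?_ ?_
  · exact (ENNReal.rpow_le_rpow hA (by norm_num)).trans_eq (hsq A)
  · exact (ENNReal.rpow_le_rpow hB (by norm_num)).trans_eq (hsq B)

open SchwartzMap in
lemma gradC_Iop_toSpt {s : ℝ} (hs : s < 1) {m₁ : Rn 3 → ℝ} (hm : IsAdmissibleMultiplier 3 s m₁)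
    (N : ℝ) (φ : 𝓢(Rn 3 × ℝ, ℂ)) (x : Rn 3) (t : ℝ) :
    gradC (Iop m₁ N (fun y ↦ φ (y, t))) x = spaceGrad (sptIop m₁ N (toSpt φ)) (spt x t) := by
  rw [← gradC_slice]
  exact congrArg (fun f ↦ gradC f x) (funext fun y ↦ Iop_slice hs hm N (toSpt φ) y t)

open SchwartzMap in
lemma exists_quadrilinear_le {s : ℝ} (hs0 : 5 / 6 < s) (hs : s < 1) {m₁ : Rn 3 → ℝ}
    (hm : IsAdmissibleMultiplier 3 s m₁) {b b' : ℝ} (hb : 1 / 2 < b) (hb1 : b ≤ 1)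
    (hb' : 9 / 20 ≤ b') (hb1' : b' ≤ 1) :
    ∃ C : ENNReal, C ≠ ⊤ ∧ ∀ N : ℝ, 1 ≤ N → ∀ Φ₁ Φ₂ Φ₃ Ψ : 𝓢(Spt, ℂ),
      ∫⁻ z, (‖Φ₂ z‖ₑ * ‖spaceGrad (sptIop m₁ N Φ₁) z‖ₑ) * (‖Φ₃ z‖ₑ * ‖Ψ z‖ₑ) ≤
        C * ENNReal.ofReal (XNorm 3 0 b' (fun x t ↦ Ψ (spt x t)) *
          XNorm 3 0 b (fun x t ↦ spaceGrad (sptIop m₁ N Φ₁) (spt x t)) *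
          XNorm 3 0 b (fun x t ↦ spaceGrad (sptIop m₁ N Φ₂) (spt x t)) *
          XNorm 3 0 b (fun x t ↦ spaceGrad (sptIop m₁ N Φ₃) (spt x t))) := by
  obtain ⟨C, hC, h⟩ := exists_bilinear_le hs0 hs hm hb hb1
  have hsq : (C ^ (1 / 2 : ℝ)) ^ 2 = C := by
    rw [← ENNReal.rpow_natCast, ← ENNReal.rpow_mul]; norm_num
  refine ⟨C, hC, fun N hN Φ₁ Φ₂ Φ₃ Ψ ↦ ?_⟩
  have h1 := h N hN Φ₂ (spaceGrad (sptIop m₁ N Φ₁)) b (by linarith) hb1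
  have h2 := h N hN Φ₃ Ψ b' hb' hb1'
  have hmeas : ∀ {H : Type} [NormedAddCommGroup H] [NormedSpace ℝ H] (f : 𝓢(Spt, H)),
      Measurable fun z ↦ ‖f z‖ₑ := fun f ↦ f.continuous.enorm.measurable
  have hm1 := hmeas (spaceGrad (sptIop m₁ N Φ₁))
  have hm2 := hmeas Φ₂
  have hm3 := hmeas Φ₃
  have hm4 := hmeas Ψ
  rw [← hsq, ← mul_pow, ← mul_pow] at h1 h2
  refine (lintegral_mul_le_of_sq_le (by fun_prop) (by fun_prop) h1 h2).trans (le_of_eq ?_)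
  have hX := @XNorm_nonneg
  rw [ENNReal.ofReal_mul (mul_nonneg (mul_nonneg (hX _ _) (hX _ _)) (hX _ _)),
    ENNReal.ofReal_mul (mul_nonneg (hX _ _) (hX _ _)), ENNReal.ofReal_mul (hX _ _)]
  conv_rhs => rw [← hsq]
  ring

end Quadrilinear

/-- Quadrilinear L¹ estimate in ℝ^{3+1}. -/
theorem statement_14 :
    ∀ s : ℝ, 5/6 < s → s < 1 →
    ∀ m₁ : Rn 3 → ℝ, IsAdmissibleMultiplier 3 s m₁ →
    ∃ ε₀ > (0:ℝ), ∀ ε : ℝ, 0 < ε → ε < ε₀ →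
    ∃ C > (0:ℝ),
    ∀ N : ℝ, 1 ≤ N →
    ∀ φ₁ φ₂ φ₃ ψ : SchwartzMap (Rn 3 × ℝ) ℂ,
    lpNormST 3 1 (fun x t =>
        ((starRingEnd ℂ) (φ₂ (x, t)) * φ₃ (x, t) * ψ (x, t)) •
          gradC (Iop m₁ N (fun y => φ₁ (y, t))) x)
      ≤ C * XNorm 3 0 (1/2 - 2 * ε) (fun x t => ψ (x, t)) *
          XNorm 3 0 (1/2 + ε) (fun x t => gradC (Iop m₁ N (fun y => φ₁ (y, t))) x) *
          XNorm 3 0 (1/2 + ε) (fun x t => gradC (Iop m₁ N (fun y => φ₂ (y, t))) x) *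
          XNorm 3 0 (1/2 + ε) (fun x t => gradC (Iop m₁ N (fun y => φ₃ (y, t))) x) := by
  intro s hs0 hs m₁ hm
  refine ⟨1 / 40, by norm_num, fun ε hε hε' ↦ ?_⟩
  obtain ⟨C, hC, h⟩ := exists_quadrilinear_le hs0 hs hm (b := 1 / 2 + ε) (b' := 1 / 2 - 2 * ε)
    (by linarith) (by linarith) (by linarith) (by linarith)
  refine ⟨C.toReal + 1, by positivity, fun N hN φ₁ φ₂ φ₃ ψ ↦ ?_⟩
  have hX := @XNorm_nonneg
  simp only [gradC_Iop_toSpt hs hm, mul_assoc (C.toReal + 1)]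
  refine le_trans ?_ (mul_le_mul_of_nonneg_right (le_add_of_nonneg_right zero_le_one)
    (mul_nonneg (mul_nonneg (mul_nonneg (hX _ _) (hX _ _)) (hX _ _)) (hX _ _)))
  rw [← ENNReal.ofReal_le_ofReal_iff (mul_nonneg ENNReal.toReal_nonneg
    (mul_nonneg (mul_nonneg (mul_nonneg (hX _ _) (hX _ _)) (hX _ _)) (hX _ _))),
    ENNReal.ofReal_mul ENNReal.toReal_nonneg, ENNReal.ofReal_toReal hC]
  refine le_trans ?_ (h N hN (toSpt φ₁) (toSpt φ₂) (toSpt φ₃) (toSpt ψ))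
  simp only [lpNormST, Real.rpow_one, div_one]
  refine (ofReal_integral_integral_norm_le _).trans (le_of_eq ?_)
  have hmeas : ∀ {H : Type} [NormedAddCommGroup H] [NormedSpace ℝ H] (f : SchwartzMap Spt H),
      Measurable fun z ↦ ‖f z‖ₑ := fun f ↦ f.continuous.enorm.measurable
  have hm1 := hmeas (spaceGrad (sptIop m₁ N (toSpt φ₁)))
  have hm2 := hmeas (toSpt φ₂)
  have hm3 := hmeas (toSpt φ₃)
  have hm4 := hmeas (toSpt ψ)
  rw [lintegral_spt_symm (by fun_prop)]
  refine lintegral_congr fun t ↦ lintegral_congr fun x ↦ ?_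
  simp only [enorm_smul, enorm_mul, toSpt_spt, RCLike.enorm_conj]
  ring

end
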